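/- Let g_1,…,g_k ∈ ℝ[x] be nonzero polynomials in n variables such that the set X = {x ∈ ℝ^n : g_1(x) ≥ 0, …, g_k(x) ≥ 0} has non-empty interior, let d_0,…,d_k ∈ ℤ_+, and let C = Σ_{n,2d_0} + g_1·Σ_{n,2d_1} + ⋯ + g_k·Σ_{n,2d_k} be the truncated quadratic module generated by g_1,…,g_k with truncation degrees 2d_0,…,2d_k. Then sxdeg(C) = C(n+d,n), where d = max{d_0,…,d_k}. -/

import Mathlib

open MvPolynomial

/-- The cone of `m`-tuples of `k × k` real positive semidefinite matrices, `(𝒮₊ᵏ)^m`. -/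
def PSDTuple (k m : ℕ) : Set (Fin m → Matrix (Fin k) (Fin k) ℝ) :=
  {A | ∀ i, (A i).PosSemidef}

/-- The cone `𝒮₊ᵏ` of `k × k` real positive semidefinite matrices. -/
def PSDCone (k : ℕ) : Set (Matrix (Fin k) (Fin k) ℝ) :=
  {A | A.PosSemidef}

/-- `S ⊆ V` has a `K`-lift if `S = π(K ∩ H)` for an affine subspace `H` and a linear map `π`. -/
def HasLift {W V : Type*} [AddCommGroup W] [Module ℝ W] [AddCommGroup V] [Module ℝ V]
    (K : Set W) (S : Set V) : Prop :=
  ∃ (H : AffineSubspace ℝ W) (p : W →ₗ[ℝ] V), S = p '' (K ∩ (H : Set W))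

/-- Semidefinite extension degree: the smallest `k` such that `S` has an `(𝒮₊ᵏ)^m`-lift
for some finite `m` (`⊤` if there is no such `k`). -/
noncomputable def sxdeg {V : Type*} [AddCommGroup V] [Module ℝ V] (S : Set V) : ℕ∞ :=
  sInf {c : ℕ∞ | ∃ k m : ℕ, c = (k : ℕ∞) ∧ HasLift (PSDTuple k m) S}

/-- Semidefinite extension complexity: the smallest `k` such that `S` has an `𝒮₊ᵏ`-lift. -/
noncomputable def sxc {V : Type*} [AddCommGroup V] [Module ℝ V] (S : Set V) : ℕ∞ :=
  sInf {c : ℕ∞ | ∃ k : ℕ, c = (k : ℕ∞) ∧ HasLift (PSDCone k) S}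

/-- Coefficient embedding of polynomials into the product space `(Fin n →₀ ℕ) → ℝ`;
used to express topological notions (closedness) for sets of polynomials. -/
noncomputable def coeffMap (n : ℕ) : MvPolynomial (Fin n) ℝ →ₗ[ℝ] ((Fin n →₀ ℕ) → ℝ) where
  toFun f := fun a => coeff a f
  map_add' := by intros; funext; simp
  map_smul' := by intros; funext; simp

/-- `Σ_{n,2d}`: sums of squares of polynomials, of degree at most `2d`, in `n` variables. -/
def SOSCone (n d : ℕ) : Set (MvPolynomial (Fin n) ℝ) :=
  {f | f.totalDegree ≤ 2 * d ∧
    ∃ (r : ℕ) (g : Fin r → MvPolynomial (Fin n) ℝ), f = ∑ i, g i ^ 2}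

/-- `P_{n,2d}(X)`: polynomials of degree at most `2d` that are nonnegative on `X`. -/
def PosCone (n d : ℕ) (X : Set (Fin n → ℝ)) : Set (MvPolynomial (Fin n) ℝ) :=
  {f | f.totalDegree ≤ 2 * d ∧ ∀ x ∈ X, 0 ≤ MvPolynomial.eval x f}

/-- The vector `v_{n,d}(x) = (x^α)_{|α| ≤ d}` of all monomials of degree at most `d`
evaluated at `x`, regarded inside the coordinate space `(Fin n →₀ ℕ) → ℝ`. -/
noncomputable def monVec (n d : ℕ) (x : Fin n → ℝ) : (Fin n →₀ ℕ) → ℝ :=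
  fun a => if (a.sum fun _ e => e) ≤ d then ∏ i, x i ^ a i else 0

/-- The convex conic hull: all finite nonnegative combinations of elements of `s`. -/
def coneHull {V : Type*} [AddCommGroup V] [Module ℝ V] (s : Set V) : Set V :=
  {y | ∃ (r : ℕ) (c : Fin r → ℝ) (v : Fin r → V),
    (∀ i, 0 ≤ c i) ∧ (∀ i, v i ∈ s) ∧ y = ∑ i, c i • v i}

lemma exists_finset_eventually_le_iSup {ι P E : Type*} [Finite ι] [AddCommGroup E] [Module ℝ E]
    [FiniteDimensional ℝ E] (U : Ultrafilter P) (W : ι → P → Submodule ℝ E) (s : ℕ) :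
    ∀ V : ι → Submodule ℝ E,
      (∀ i, (∀ᶠ x in U, W i x ≤ V i) ∨ Module.finrank ℝ E ≤ Module.finrank ℝ (V i) + s) →
      ∃ T : Finset P, T.card ≤ s ∧ ∀ i, ∀ᶠ x in U, W i x ≤ V i ⊔ ⨆ y ∈ T, W i y := by
  classical
  induction s with
  | zero =>
    intro V hV
    refine ⟨∅, by simp, fun i => ?_⟩
    rcases hV i with h | h
    · filter_upwards [h] with x hx using hx.trans le_sup_left
    · have : V i = ⊤ := Submodule.eq_top_of_finrank_eq
        (le_antisymm (Submodule.finrank_le _) (by simpa using h))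
      simp [this]
  | succ s ih =>
    intro V hV
    have key : ∀ᶠ x in U, ∀ i, (∀ᶠ y in U, W i y ≤ V i) ∨ ¬ W i x ≤ V i := by
      refine Filter.eventually_all.2 fun i => ?_
      by_cases h : ∀ᶠ y in U, W i y ≤ V i
      · simp [h]
      · filter_upwards [Ultrafilter.eventually_not.2 h] with x hx using Or.inr hx
    obtain ⟨x₀, hx₀⟩ := key.exists
    obtain ⟨T, hT, hW⟩ := ih (fun i => V i ⊔ W i x₀) (fun i => by
      rcases hx₀ i with h | h
      · left
        filter_upwards [h] with x hx using hx.trans le_sup_left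
      · rcases hV i with h' | h'
        · left
          filter_upwards [h'] with x hx using hx.trans le_sup_left
        · right
          have : Module.finrank ℝ (V i) < Module.finrank ℝ (V i ⊔ W i x₀ : Submodule ℝ E) :=
            Submodule.finrank_lt_finrank_of_lt (by simpa using h)
          omega)
    refine ⟨insert x₀ T, (Finset.card_insert_le _ _).trans (by omega), fun i => ?_⟩
    filter_upwards [hW i] with x hx
    rwa [Finset.iSup_insert, ← sup_assoc]

lemma LinearMap.exists_comp_eq_of_ker_le {E F G : Type*} [AddCommGroup E] [Module ℝ E]
    [AddCommGroup F] [Module ℝ F] [AddCommGroup G] [Module ℝ G] (f : E →ₗ[ℝ] F) (g : E →ₗ[ℝ] G)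
    (h : LinearMap.ker f ≤ LinearMap.ker g) : ∃ φ : F →ₗ[ℝ] G, φ ∘ₗ f = g := by
  obtain ⟨s, hs⟩ := f.rangeRestrict.exists_rightInverse_of_surjective f.range_rangeRestrict
  obtain ⟨φ, hφ⟩ := (g ∘ₗ s).exists_extend
  refine ⟨φ, LinearMap.ext fun x => ?_⟩
  have h1 : φ (f x) = g (s (f.rangeRestrict x)) := LinearMap.congr_fun hφ (f.rangeRestrict x)
  have h2 : s (f.rangeRestrict x) - x ∈ LinearMap.ker f := by
    have := congrArg Subtype.val (LinearMap.congr_fun hs (f.rangeRestrict x))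
    simpa [sub_eq_zero] using this
  have h3 := h h2
  rw [LinearMap.mem_ker, map_sub, sub_eq_zero] at h3
  rw [LinearMap.comp_apply, h1, h3]

open scoped MatrixOrder ComplexOrder Matrix.Norms.L2Operator in
lemma Matrix.PosSemidef.exists_eq_transpose_mul_self {r : ℕ} {A : Matrix (Fin r) (Fin r) ℝ}
    (hA : A.PosSemidef) : ∃ B : Matrix (Fin r) (Fin r) ℝ, A = B.transpose * B := by
  obtain ⟨B, hB⟩ := CStarAlgebra.nonneg_iff_eq_star_mul_self.mp hA.nonneg
  exact ⟨B, by simpa [Matrix.star_eq_conjTranspose] using hB⟩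

lemma exists_forall_dotProduct_self_le {r : ℕ} (Z : Matrix (Fin r) (Fin r) ℝ) :
    ∃ c : ℝ, 0 ≤ c ∧ ∀ w : Fin r → ℝ, Z.mulVec w ⬝ᵥ Z.mulVec w ≤ c * (w ⬝ᵥ w) := by
  refine ⟨∑ i, ∑ j, Z i j ^ 2, by positivity, fun w => ?_⟩
  rw [Finset.sum_mul]
  refine Finset.sum_le_sum fun i _ => ?_
  have := Finset.sum_mul_sq_le_sq_mul_sq Finset.univ (Z i) w
  simpa [Matrix.mulVec, dotProduct, pow_two] using this

lemma exists_forall_dotProduct_mulVec_le {r : ℕ} {A M : Matrix (Fin r) (Fin r) ℝ}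
    (hA : A.PosSemidef) (hM : M.PosSemidef)
    (h : LinearMap.ker A.mulVecLin ≤ LinearMap.ker M.mulVecLin) :
    ∃ c : ℝ, 0 ≤ c ∧ ∀ v : Fin r → ℝ, v ⬝ᵥ M.mulVec v ≤ c * (v ⬝ᵥ A.mulVec v) := by
  obtain ⟨B, rfl⟩ := hA.exists_eq_transpose_mul_self
  obtain ⟨C, rfl⟩ := hM.exists_eq_transpose_mul_self
  have quad : ∀ (D : Matrix (Fin r) (Fin r) ℝ) (v : Fin r → ℝ),
      v ⬝ᵥ (D.transpose * D).mulVec v = D.mulVec v ⬝ᵥ D.mulVec v := fun D v => by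
    rw [← Matrix.mulVec_mulVec, Matrix.dotProduct_mulVec, Matrix.vecMul_transpose]
  have hker : LinearMap.ker B.mulVecLin ≤ LinearMap.ker C.mulVecLin := by
    intro v hv
    have hv' : B.mulVec v = 0 := hv
    have h1 : (C.transpose * C).mulVec v = 0 :=
      h (show (B.transpose * B).mulVec v = 0 by rw [← Matrix.mulVec_mulVec, hv']; simp)
    have h2 := quad C v
    rw [h1, dotProduct_zero] at h2
    exact dotProduct_self_eq_zero.1 h2.symm
  obtain ⟨φ, hφ⟩ := LinearMap.exists_comp_eq_of_ker_le _ _ hker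
  obtain ⟨c, hc, hle⟩ := exists_forall_dotProduct_self_le (LinearMap.toMatrix' φ)
  refine ⟨c, hc, fun v => ?_⟩
  have h3 : C.mulVec v = (LinearMap.toMatrix' φ).mulVec (B.mulVec v) := by
    rw [LinearMap.toMatrix'_mulVec]
    exact (LinearMap.congr_fun hφ v).symm
  rw [quad, quad, h3]
  exact hle _

lemma PSDTuple.lineMap_mem_of_nonneg {r m : ℕ} {A B : Fin m → Matrix (Fin r) (Fin r) ℝ}
    (hA : A ∈ PSDTuple r m) (hB : B ∈ PSDTuple r m)
    (h : ∀ i, LinearMap.ker (A i).mulVecLin ≤ LinearMap.ker (B i).mulVecLin) :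
    ∃ ε : ℝ, 0 < ε ∧ AffineMap.lineMap A B (-ε) ∈ PSDTuple r m := by
  choose c hc hle using fun i => exists_forall_dotProduct_mulVec_le (hA i) (hB i) (h i)
  have hs : 0 ≤ ∑ i, c i := Finset.sum_nonneg fun i _ => hc i
  refine ⟨1 / (∑ i, c i + 1), by positivity, fun i => ?_⟩
  set ε := 1 / (∑ i, c i + 1) with hε
  have hεc : ε * c i ≤ 1 := by
    have : c i ≤ ∑ i, c i := Finset.single_le_sum (fun i _ => hc i) (Finset.mem_univ i)
    rw [hε, one_div, inv_mul_le_iff₀ (by positivity)]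
    linarith
  have hε0 : 0 < ε := by positivity
  have heq : AffineMap.lineMap A B (-ε) i = (1 + ε) • A i - ε • B i := by
    rw [AffineMap.lineMap_apply_module]
    simp [sub_eq_add_neg]
  rw [heq]
  refine Matrix.PosSemidef.of_dotProduct_mulVec_nonneg ?_ fun v => ?_
  · exact ((hA i).smul (by positivity : 0 ≤ 1 + ε)).1.sub ((hB i).smul hε0.le).1
  · have h1 := hle i v
    have h2 : 0 ≤ v ⬝ᵥ (A i).mulVec v := by simpa using (hA i).dotProduct_mulVec_nonneg v
    rw [star_trivial, Matrix.sub_mulVec, Matrix.smul_mulVec, Matrix.smul_mulVec, dotProduct_sub,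
      dotProduct_smul, dotProduct_smul, smul_eq_mul, smul_eq_mul]
    nlinarith [mul_le_mul_of_nonneg_left h1 hε0.le, mul_le_mul_of_nonneg_right hεc h2]

lemma Matrix.PosSemidef.mulVec_eq_zero_of_add {r : ℕ} {A B : Matrix (Fin r) (Fin r) ℝ}
    (hA : A.PosSemidef) (hB : B.PosSemidef) {v : Fin r → ℝ} (h : (A + B).mulVec v = 0) :
    A.mulVec v = 0 ∧ B.mulVec v = 0 := by
  have h1 := hA.dotProduct_mulVec_nonneg v
  have h2 := hB.dotProduct_mulVec_nonneg v
  have h3 : star v ⬝ᵥ A.mulVec v + star v ⬝ᵥ B.mulVec v = 0 := by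
    rw [← dotProduct_add, ← Matrix.add_mulVec, h, dotProduct_zero]
  exact ⟨(hA.dotProduct_mulVec_zero_iff v).1 (by linarith),
    (hB.dotProduct_mulVec_zero_iff v).1 (by linarith)⟩

/-- A nonempty exposed face of a spectrahedron consists of the tuples whose kernels contain those
of a suitable member of the face. -/
lemma exists_kernel_description_of_face {r m : ℕ}
    (H : AffineSubspace ℝ (Fin m → Matrix (Fin r) (Fin r) ℝ))
    (ℓ : (Fin m → Matrix (Fin r) (Fin r) ℝ) →ₗ[ℝ] ℝ)
    (hℓ : ∀ A ∈ PSDTuple r m ∩ (H : Set _), 0 ≤ ℓ A)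
    (hne : ∃ A ∈ PSDTuple r m ∩ (H : Set _), ℓ A = 0) :
    ∃ W : Fin m → Submodule ℝ (Fin r → ℝ), ∀ B ∈ PSDTuple r m ∩ (H : Set _),
      ℓ B = 0 ↔ ∀ i, W i ≤ LinearMap.ker (B i).mulVecLin := by
  let F : Set (Fin m → Matrix (Fin r) (Fin r) ℝ) := {A | A ∈ PSDTuple r m ∩ (H : Set _) ∧ ℓ A = 0}
  let δ : (Fin m → Matrix (Fin r) (Fin r) ℝ) → ℕ :=
    fun A => ∑ i, Module.finrank ℝ (LinearMap.ker (A i).mulVecLin)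
  obtain ⟨A, hA, hmin⟩ : ∃ A ∈ F, ∀ B ∈ F, δ A ≤ δ B := by
    obtain ⟨A₀, hA₀⟩ := hne
    exact ⟨_, Function.argminOn_mem δ F ⟨A₀, hA₀⟩, fun B hB => Function.argminOn_le δ F hB⟩
  obtain ⟨⟨hAP, hAH⟩, hA0⟩ := hA
  refine ⟨fun i => LinearMap.ker (A i).mulVecLin, fun B hB => ⟨fun hB0 i => ?_, fun hker => ?_⟩⟩
  · have hmid : AffineMap.lineMap A B (1 / 2 : ℝ) = (1 / 2 : ℝ) • (A + B) := by
      rw [AffineMap.lineMap_apply_module, smul_add]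
      norm_num
    set D := AffineMap.lineMap A B (1 / 2 : ℝ) with hD
    have hDF : D ∈ F := by
      refine ⟨⟨fun j => ?_, AffineMap.lineMap_mem _ hAH hB.2⟩, ?_⟩
      · rw [hmid]
        exact ((hAP j).add (hB.1 j)).smul (by norm_num : (0 : ℝ) ≤ 1 / 2)
      · rw [hmid, map_smul, map_add, hA0, hB0]
        simp
    have hDker : ∀ j, LinearMap.ker (D j).mulVecLin ≤
        LinearMap.ker (A j).mulVecLin ⊓ LinearMap.ker (B j).mulVecLin := by
      intro j v hv
      have hv' : (D j).mulVec v = 0 := hv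
      rw [hmid] at hv'
      refine (hAP j).mulVec_eq_zero_of_add (hB.1 j) ?_
      rw [Pi.smul_apply, Matrix.smul_mulVec] at hv'
      exact (smul_eq_zero.1 hv').resolve_left (by norm_num)
    have hle : ∀ j ∈ Finset.univ, Module.finrank ℝ (LinearMap.ker (D j).mulVecLin) ≤
        Module.finrank ℝ (LinearMap.ker (A j).mulVecLin) :=
      fun j _ => Submodule.finrank_mono ((hDker j).trans inf_le_left)
    have hsum : δ D = δ A := le_antisymm (Finset.sum_le_sum hle) (hmin D hDF)
    have heq := (Finset.sum_eq_sum_iff_of_le hle).1 hsum i (Finset.mem_univ i)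
    have := Submodule.eq_of_le_of_finrank_eq ((hDker i).trans inf_le_left) heq
    exact this.symm.le.trans ((hDker i).trans inf_le_right)
  · obtain ⟨ε, hε, hmem⟩ := PSDTuple.lineMap_mem_of_nonneg hAP hB.1 hker
    have h1 := hℓ _ ⟨hmem, AffineMap.lineMap_mem _ hAH hB.2⟩
    rw [AffineMap.lineMap_apply_module, map_add, map_smul, map_smul, hA0, smul_zero, zero_add,
      smul_eq_mul] at h1
    have h2 := hℓ B hB
    nlinarith

lemma exists_ultrafilter_eval_ne_zero {n : ℕ} {O : Set (Fin n → ℝ)} (hO : IsOpen O)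
    (hne : O.Nonempty) : ∃ U : Ultrafilter (Fin n → ℝ), (∀ᶠ x in U, x ∈ O) ∧
      ∀ q : MvPolynomial (Fin n) ℝ, q ≠ 0 → ∀ᶠ x in U, eval x q ≠ 0 := by
  let F : Filter (Fin n → ℝ) :=
    { sets := {S | ∃ q : MvPolynomial (Fin n) ℝ, q ≠ 0 ∧ ∀ x ∈ O, eval x q ≠ 0 → x ∈ S}
      univ_sets := ⟨1, one_ne_zero, fun _ _ _ => trivial⟩
      sets_of_superset := fun ⟨q, hq, h⟩ hST => ⟨q, hq, fun x hx hqx => hST (h x hx hqx)⟩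
      inter_sets := by
        rintro S T ⟨p, hp, hS⟩ ⟨q, hq, hT⟩
        refine ⟨p * q, mul_ne_zero hp hq, fun x hx h => ?_⟩
        rw [map_mul] at h
        exact ⟨hS x hx (left_ne_zero_of_mul h), hT x hx (right_ne_zero_of_mul h)⟩ }
  have hF : F.NeBot := by
    refine ⟨fun hbot => ?_⟩
    obtain ⟨q, hq, h⟩ : (∅ : Set (Fin n → ℝ)) ∈ F := hbot ▸ Filter.mem_bot
    obtain ⟨x₀, hx₀⟩ := hne
    obtain ⟨ε, hε, hball⟩ := Metric.isOpen_iff.1 hO x₀ hx₀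
    refine hq (MvPolynomial.funext_set (fun i => Metric.ball (x₀ i) ε) (fun i => ?_)
      fun x hx => ?_)
    · rw [Real.ball_eq_Ioo]
      exact Set.Ioo_infinite (by linarith)
    · rw [map_zero]
      by_contra hne0
      refine h x (hball ?_) hne0
      rw [ball_pi x₀ hε]
      exact hx
  refine ⟨Ultrafilter.of F, ?_, fun q hq => ?_⟩
  · exact Ultrafilter.of_le F ⟨1, one_ne_zero, fun x hx _ => hx⟩
  · exact Ultrafilter.of_le F ⟨q, hq, fun x _ h => h⟩

lemma finrank_restrictTotalDegree (n d : ℕ) :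
    Module.finrank ℝ (restrictTotalDegree (Fin n) ℝ d) = (n + d).choose n := by
  have hset : {a : Fin n →₀ ℕ | (a.sum fun _ e => e) ≤ d} =
      ((Finset.range (d + 1)).biUnion fun e =>
        Finset.finsuppAntidiag (Finset.univ : Finset (Fin n)) e : Finset (Fin n →₀ ℕ)) := by
    ext a
    simp [Finsupp.sum_fintype]
  rw [restrictTotalDegree, Module.finrank_eq_nat_card_basis (basisRestrictSupport ℝ _), Nat.card_coe_set_eq, hset,
    Set.ncard_coe_finset, Finset.card_biUnion, add_comm n d, ← Nat.sum_range_multichoose]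
  · refine Finset.sum_congr rfl fun e _ => ?_
    simp [Finset.card_finsuppAntidiag_nat_eq_multichoose]
  · intro i _ j _ hij
    rw [Function.onFun, Finset.disjoint_left]
    intro a ha hb
    rw [Finset.mem_finsuppAntidiag] at ha hb
    exact hij (ha.1.symm.trans hb.1)

lemma totalDegree_le_of_sum_sq {n e r : ℕ} (q : Fin r → MvPolynomial (Fin n) ℝ)
    (h : (∑ i, q i ^ 2).totalDegree ≤ 2 * e) (i : Fin r) : (q i).totalDegree ≤ e := by
  let o : MonomialOrder (Fin n) := MonomialOrder.degLex
  obtain ⟨j, -, hj⟩ := Finset.exists_max_image Finset.univ (fun i => o.toSyn (o.degree (q i)))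
    ⟨i, Finset.mem_univ i⟩
  have hij : (q i).totalDegree ≤ (q j).totalDegree :=
    degLex_totalDegree_monotone (hj i (Finset.mem_univ i))
  refine hij.trans ?_
  by_cases hq : q j = 0
  · simp [hq]
  set a := o.degree (q j) with ha
  have hcoeff : coeff (a + a) (∑ i, q i ^ 2) = ∑ i, coeff a (q i) ^ 2 := by
    rw [coeff_sum]
    refine Finset.sum_congr rfl fun l hl => ?_
    rw [pow_two, pow_two]
    exact o.coeff_mul_of_add_of_degree_le (hj l hl) (hj l hl)
  have hpos : 0 < ∑ i, coeff a (q i) ^ 2 := by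
    refine Finset.sum_pos' (fun _ _ => sq_nonneg _) ⟨j, Finset.mem_univ j, ?_⟩
    have : coeff a (q j) ≠ 0 := o.coeff_degree_ne_zero_iff.2 hq
    positivity
  have hle : (a + a).degree ≤ (∑ i, q i ^ 2).totalDegree :=
    le_totalDegree (mem_support_iff.2 (hcoeff ▸ hpos.ne'))
  have hdeg : a.degree = (q j).totalDegree := degree_degLexDegree
  rw [map_add, hdeg] at hle
  omega

/-- The polynomial with Gram matrix `A` with respect to the family `b`. -/
noncomputable def gramPolynomial {n N : ℕ} (b : Fin N → MvPolynomial (Fin n) ℝ) :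
    Matrix (Fin N) (Fin N) ℝ →ₗ[ℝ] MvPolynomial (Fin n) ℝ where
  toFun A := ∑ i, ∑ j, A i j • (b i * b j)
  map_add' A B := by simp [add_smul, Finset.sum_add_distrib]
  map_smul' c A := by simp [Finset.smul_sum, mul_smul]

lemma gramPolynomial_transpose_mul_self {n N r : ℕ} (b : Fin N → MvPolynomial (Fin n) ℝ)
    (B : Matrix (Fin r) (Fin N) ℝ) :
    gramPolynomial b (B.transpose * B) = ∑ t, (∑ i, B t i • b i) ^ 2 := by
  change ∑ i, ∑ j, (B.transpose * B) i j • (b i * b j) = _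
  simp only [pow_two, Finset.sum_mul_sum, smul_mul_smul_comm, Matrix.mul_apply,
    Matrix.transpose_apply, Finset.sum_smul]
  symm
  rw [Finset.sum_comm]
  refine Finset.sum_congr rfl fun i _ => ?_
  rw [Finset.sum_comm]

lemma exists_vanishing_polynomial {n d : ℕ} (T : Finset (Fin n → ℝ))
    (hT : T.card < (n + d).choose n) :
    ∃ q : MvPolynomial (Fin n) ℝ, q ≠ 0 ∧ q.totalDegree ≤ d ∧ ∀ y ∈ T, eval y q = 0 := by
  let φ : restrictTotalDegree (Fin n) ℝ d →ₗ[ℝ] (T → ℝ) :=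
    LinearMap.pi fun y => (aeval (y : Fin n → ℝ)).toLinearMap ∘ₗ Submodule.subtype _
  have hker : LinearMap.ker φ ≠ ⊥ := LinearMap.ker_ne_bot_of_finrank_lt (by
    rw [finrank_restrictTotalDegree, Module.finrank_fintype_fun_eq_card, Fintype.card_coe]
    exact hT)
  obtain ⟨q, hq, hq0⟩ := Submodule.exists_mem_ne_zero_of_ne_bot hker
  refine ⟨q, by simpa using hq0, (mem_restrictTotalDegree _ _ _).1 q.2, fun y hy => ?_⟩
  have := congrFun (LinearMap.mem_ker.1 hq) ⟨y, hy⟩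
  simpa [φ, coe_aeval_eq_eval] using this

lemma choose_le_of_hasLift {n d r m : ℕ} {C : Set (MvPolynomial (Fin n) ℝ)}
    {O : Set (Fin n → ℝ)} (hO : IsOpen O) (hne : O.Nonempty) {g : MvPolynomial (Fin n) ℝ}
    (hg : g ≠ 0) (hpos : ∀ x ∈ O, ∀ f ∈ C, 0 ≤ eval x f) (h0 : 0 ∈ C)
    (hmem : ∀ q : MvPolynomial (Fin n) ℝ, q.totalDegree ≤ d → g * q ^ 2 ∈ C)
    (hlift : HasLift (PSDTuple r m) C) : (n + d).choose n ≤ r := by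
  obtain ⟨H, p, rfl⟩ := hlift
  obtain ⟨U, hUO, hU⟩ := exists_ultrafilter_eval_ne_zero hO hne
  have hface : ∀ x : Fin n → ℝ, ∃ W : Fin m → Submodule ℝ (Fin r → ℝ),
      (x ∈ O → ∀ B ∈ PSDTuple r m ∩ (H : Set _),
        eval x (p B) = 0 ↔ ∀ i, W i ≤ LinearMap.ker (B i).mulVecLin) ∧
      (x ∉ O → ∀ i, W i = ⊥) := by
    intro x
    by_cases hx : x ∈ O
    · obtain ⟨W, hW⟩ := exists_kernel_description_of_face H
        ((aeval x).toLinearMap ∘ₗ p : _ →ₗ[ℝ] ℝ)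
        (fun A hA => by simpa [coe_aeval_eq_eval] using hpos x hx _ ⟨A, hA, rfl⟩) (by
          obtain ⟨A, hA, hpA⟩ := h0
          exact ⟨A, hA, by simp [hpA]⟩)
      refine ⟨W, fun _ B hB => ?_, fun h => absurd hx h⟩
      simpa [coe_aeval_eq_eval] using hW B hB
    · exact ⟨fun _ => ⊥, fun h => absurd h hx, fun _ _ => rfl⟩
  choose W hW hW' using hface
  by_contra! hlt
  obtain ⟨T, hT, hTW⟩ := exists_finset_eventually_le_iSup U (fun i x => W x i) r (fun _ => ⊥)
    (fun i => Or.inr (by simp))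
  obtain ⟨q, hq0, hqd, hqT⟩ := exists_vanishing_polynomial T (hT.trans_lt hlt)
  obtain ⟨A, hA, hpA⟩ := hmem q hqd
  obtain ⟨x, hxO, hxq, hxg, hxW⟩ :=
    (hUO.and ((hU q hq0).and ((hU g hg).and (Filter.eventually_all.2 hTW)))).exists
  have hvan : eval x (p A) = 0 := by
    refine (hW x hxO A hA).2 fun i => (hxW i).trans (sup_le bot_le (iSup₂_le fun y hy => ?_))
    by_cases hyO : y ∈ O
    · exact (hW y hyO A hA).1 (by rw [hpA]; simp [hqT y hy]) i
    · simp [hW' y hyO i]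
  rw [hpA, map_mul, map_pow] at hvan
  exact mul_ne_zero hxg (pow_ne_zero 2 hxq) hvan

lemma mem_SOSCone_iff_exists_gramPolynomial {n d e : ℕ} (he : e ≤ d)
    {N : ℕ} (b : Module.Basis (Fin N) ℝ (restrictTotalDegree (Fin n) ℝ d))
    (f : MvPolynomial (Fin n) ℝ) :
    f ∈ SOSCone n e ↔ ∃ A : Matrix (Fin N) (Fin N) ℝ, A.PosSemidef ∧
      f = gramPolynomial (fun i => (b i : MvPolynomial (Fin n) ℝ)) A ∧ f.totalDegree ≤ 2 * e := by
  constructor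
  · rintro ⟨hdeg, r, q, rfl⟩
    have hq : ∀ t, q t ∈ restrictTotalDegree (Fin n) ℝ d := fun t =>
      (mem_restrictTotalDegree _ _ _).2 ((totalDegree_le_of_sum_sq q hdeg t).trans he)
    let B : Matrix (Fin r) (Fin N) ℝ := Matrix.of fun t i => b.repr ⟨q t, hq t⟩ i
    refine ⟨B.transpose * B, ?_, ?_, hdeg⟩
    · simpa using Matrix.posSemidef_conjTranspose_mul_self B
    · rw [gramPolynomial_transpose_mul_self]
      refine Finset.sum_congr rfl fun t _ => ?_
      have := congrArg Subtype.val (b.sum_repr ⟨q t, hq t⟩)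
      rw [Submodule.coe_sum] at this
      exact congrArg (· ^ 2) this.symm
  · rintro ⟨A, hA, rfl, hdeg⟩
    obtain ⟨B, rfl⟩ := hA.exists_eq_transpose_mul_self
    exact ⟨hdeg, N, _, gramPolynomial_transpose_mul_self _ B⟩

lemma hasLift_truncatedQuadraticModule {n d m : ℕ} (g : Fin m → MvPolynomial (Fin n) ℝ)
    (dv : Fin m → ℕ) (hd : ∀ i, dv i ≤ d) :
    HasLift (PSDTuple ((n + d).choose n) m)
      {f | ∃ s : Fin m → MvPolynomial (Fin n) ℝ, (∀ i, s i ∈ SOSCone n (dv i)) ∧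
        f = ∑ i, g i * s i} := by
  let b := Module.finBasisOfFinrankEq ℝ _ (finrank_restrictTotalDegree n d)
  let γ := gramPolynomial fun i => (b i : MvPolynomial (Fin n) ℝ)
  let H : Submodule ℝ (Fin m → Matrix _ _ ℝ) :=
    Submodule.pi Set.univ fun i => (restrictTotalDegree (Fin n) ℝ (2 * dv i)).comap γ
  have hH : ∀ A, A ∈ H ↔ ∀ i, (γ (A i)).totalDegree ≤ 2 * dv i := fun A => by
    simp [H, Submodule.mem_pi, mem_restrictTotalDegree]
  let p : (Fin m → Matrix _ _ ℝ) →ₗ[ℝ] MvPolynomial (Fin n) ℝ :=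
    ∑ i, LinearMap.mulLeft ℝ (g i) ∘ₗ γ ∘ₗ LinearMap.proj i
  have hp : ∀ A, p A = ∑ i, g i * γ (A i) := fun A => by simp [p]
  refine ⟨H.toAffineSubspace, p, Set.ext fun f => ⟨?_, ?_⟩⟩
  · rintro ⟨s, hs, rfl⟩
    choose A hA hAs hdeg using fun i =>
      (mem_SOSCone_iff_exists_gramPolynomial (hd i) b (s i)).1 (hs i)
    refine ⟨A, ⟨hA, ?_⟩, ?_⟩
    · exact (hH A).2 fun i => (congrArg totalDegree (hAs i)).symm.le.trans (hdeg i)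
    · rw [hp]
      exact Finset.sum_congr rfl fun i _ => congrArg (g i * ·) (hAs i).symm
  · rintro ⟨A, ⟨hA, hAH⟩, rfl⟩
    exact ⟨fun i => γ (A i), fun i => (mem_SOSCone_iff_exists_gramPolynomial (hd i) b _).2
      ⟨A i, hA i, rfl, (hH A).1 hAH i⟩, hp A⟩

lemma sxdeg_truncatedQuadraticModule {n d m : ℕ} (g : Fin m → MvPolynomial (Fin n) ℝ)
    (hg : ∀ i, g i ≠ 0) {O : Set (Fin n → ℝ)} (hO : IsOpen O) (hne : O.Nonempty)
    (hpos : ∀ x ∈ O, ∀ i, 0 ≤ eval x (g i)) (dv : Fin m → ℕ) (hd : ∀ i, dv i ≤ d)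
    (hmax : ∃ i, dv i = d) :
    sxdeg {f | ∃ s : Fin m → MvPolynomial (Fin n) ℝ, (∀ i, s i ∈ SOSCone n (dv i)) ∧
      f = ∑ i, g i * s i} = ((n + d).choose n : ℕ∞) := by
  have hzero : ∀ e, (0 : MvPolynomial (Fin n) ℝ) ∈ SOSCone n e := fun e =>
    ⟨by simp, 0, fun _ => 0, by simp⟩
  refine le_antisymm (sInf_le ⟨_, m, rfl, hasLift_truncatedQuadraticModule g dv hd⟩)
    (le_sInf ?_)
  rintro c ⟨r, l, rfl, hlift⟩
  obtain ⟨i₀, hi₀⟩ := hmax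
  refine Nat.cast_le.2 (choose_le_of_hasLift hO hne (hg i₀) ?_ ?_ ?_ hlift)
  · rintro x hx _ ⟨s, hs, rfl⟩
    rw [map_sum]
    refine Finset.sum_nonneg fun i _ => ?_
    obtain ⟨-, t, q, hq⟩ := hs i
    rw [map_mul, hq, map_sum]
    exact mul_nonneg (hpos x hx i)
      (Finset.sum_nonneg fun j _ => by rw [map_pow]; exact sq_nonneg _)
  · exact ⟨fun _ => 0, fun i => hzero _, by simp⟩
  · intro q hq
    refine ⟨Pi.single i₀ (q ^ 2), fun i => ?_, ?_⟩
    · by_cases hi : i = i₀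
      · subst hi
        rw [Pi.single_eq_same]
        refine ⟨(totalDegree_pow q 2).trans (by omega), 1, fun _ => q, by simp⟩
      · rw [Pi.single_eq_of_ne hi]
        exact hzero _
    · rw [Finset.sum_eq_single i₀] <;> simp +contextual

/-- Corollary 2.4: for nonzero `g₁,…,g_k` whose common nonnegativity set `X` has nonempty
interior, the truncated quadratic module `C = Σ_{n,2d₀} + g₁Σ_{n,2d₁} + ⋯ + g_kΣ_{n,2d_k}`
satisfies `sxdeg(C) = C(n+d,n)` with `d = max{d₀,…,d_k}`. -/
theorem stmt_3 (n k : ℕ) (hn : 1 ≤ n) (hk : 1 ≤ k)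
    (g : Fin k → MvPolynomial (Fin n) ℝ) (hg : ∀ i, g i ≠ 0)
    (X : Set (Fin n → ℝ))
    (hXdef : X = {x | ∀ i, 0 ≤ MvPolynomial.eval x (g i)})
    (hX : (interior X).Nonempty)
    (d0 : ℕ) (dv : Fin k → ℕ)
    (C : Set (MvPolynomial (Fin n) ℝ))
    (hC : C = {f | ∃ (s0 : MvPolynomial (Fin n) ℝ) (s : Fin k → MvPolynomial (Fin n) ℝ),
      s0 ∈ SOSCone n d0 ∧ (∀ i, s i ∈ SOSCone n (dv i)) ∧ f = s0 + ∑ i, g i * s i})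
    (d : ℕ) (hd : d = max d0 (Finset.univ.sup dv)) :
    sxdeg C = (Nat.choose (n + d) n : ℕ∞) := by
  have hset : C = {f | ∃ s : Fin (k + 1) → MvPolynomial (Fin n) ℝ,
      (∀ i, s i ∈ SOSCone n ((Fin.cons d0 dv : Fin (k + 1) → ℕ) i)) ∧
      f = ∑ i, (Fin.cons 1 g : Fin (k + 1) → MvPolynomial (Fin n) ℝ) i * s i} := by
    rw [hC]
    ext f
    constructor
    · rintro ⟨s0, s, h0, hs, rfl⟩
      exact ⟨Fin.cons s0 s, Fin.cases h0 hs, by simp [Fin.sum_univ_succ]⟩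
    · rintro ⟨s, hs, rfl⟩
      exact ⟨s 0, fun i => s i.succ, hs 0, fun i => hs i.succ, by simp [Fin.sum_univ_succ]⟩
  rw [hset]
  refine sxdeg_truncatedQuadraticModule _ (Fin.cases one_ne_zero hg) isOpen_interior hX ?_ _ ?_ ?_
  · intro x hx
    have hxX := interior_subset hx
    rw [hXdef] at hxX
    exact Fin.cases (by simp) hxX
  · rw [hd]
    exact Fin.cases (le_max_left _ _)
      fun i => (Finset.le_sup (f := dv) (Finset.mem_univ i)).trans (le_max_right _ _)
  · rcases max_choice d0 (Finset.univ.sup dv) with h | h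
    · exact ⟨0, (hd.trans h).symm⟩
    · have : Nonempty (Fin k) := ⟨⟨0, hk⟩⟩
      obtain ⟨i, -, hi⟩ := Finset.exists_mem_eq_sup Finset.univ Finset.univ_nonempty dv
      exact ⟨i.succ, (hd.trans (h.trans hi)).symm⟩
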